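/- Let (Z, ‖·‖) be a Banach space. Suppose that for every ε > 0 there exists δ > 0 with the property that ‖x + y‖ ≤ 2(1 − δ) whenever x, y ∈ Z satisfy ‖x‖ < 1, ‖y‖ < 1 and ‖x − y‖ > ε. Then Z is reflexive, i.e. the canonical inclusion of Z into its double dual is surjective. -/

import Mathlib

set_option maxSynthPendingDepth 3

open Filter Topology NormedSpace

theorem exists_norm_lt_one_lt_apply_of_lt_opNorm {E : Type*} [NormedAddCommGroup E]
    [NormedSpace ℝ E] (f : StrongDual ℝ E) {r : ℝ} (hr : r < ‖f‖) : ∃ x, ‖x‖ < 1 ∧ r < f x := by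
  obtain ⟨x, hx, hxr⟩ := f.exists_lt_apply_of_lt_opNorm hr
  rcases abs_cases (f x) with ⟨hf, -⟩ | ⟨hf, -⟩
  · exact ⟨x, hx, by rwa [Real.norm_eq_abs, hf] at hxr⟩
  · exact ⟨-x, by simpa using hx, by rwa [Real.norm_eq_abs, hf, ← map_neg] at hxr⟩

/-- **Goldstine's theorem**: the image of the open unit ball is weak-* dense in the closed unit
ball of the double dual. -/
theorem toWeakDual_mem_closure_inclusionInDoubleDual_image_ball {E : Type*}
    [NormedAddCommGroup E] [NormedSpace ℝ E] {Φ : StrongDual ℝ (StrongDual ℝ E)} (hΦ : ‖Φ‖ ≤ 1) :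
    StrongDual.toWeakDual Φ ∈ closure
      ((fun x : E ↦ StrongDual.toWeakDual (inclusionInDoubleDual ℝ E x)) '' Metric.ball 0 1) := by
  by_contra hmem
  have : LocallyConvexSpace ℝ (WeakDual ℝ (StrongDual ℝ E)) :=
    WeakBilin.locallyConvexSpace (𝕜 := ℝ) (B := topDualPairing ℝ (StrongDual ℝ E))
  have hconv : Convex ℝ
      ((fun x : E ↦ StrongDual.toWeakDual (inclusionInDoubleDual ℝ E x)) '' Metric.ball 0 1) :=
    (convex_ball (0 : E) 1).linear_image
      ((StrongDual.toWeakDual (𝕜 := ℝ) (E := StrongDual ℝ E)).toLinearMap ∘ₗ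
        (inclusionInDoubleDual ℝ E).toLinearMap)
  obtain ⟨F, u, hFu, huF⟩ :=
    geometric_hahn_banach_closed_point hconv.closure isClosed_closure hmem
  obtain ⟨g, rfl⟩ := LinearMap.dualEmbedding_surjective (𝕜 := ℝ) (topDualPairing ℝ (StrongDual ℝ E)) F
  have hlt : ∀ x : E, ‖x‖ < 1 → g x < u := fun x hx ↦
    hFu _ (subset_closure ⟨x, by simpa using hx, rfl⟩)
  have hΦg : u < Φ g := huF
  have hu : u < ‖g‖ := hΦg.trans_le <| (le_abs_self _).trans <|
    (Φ.le_of_opNorm_le hΦ g).trans_eq (one_mul _)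
  obtain ⟨x, hx, hxu⟩ := exists_norm_lt_one_lt_apply_of_lt_opNorm g hu
  exact (hlt x hx).not_gt hxu

/-- **Milman–Pettis** on the unit sphere of the double dual. -/
theorem exists_inclusionInDoubleDual_eq_of_norm_eq_one {Z : Type*} [NormedAddCommGroup Z]
    [NormedSpace ℝ Z] [CompleteSpace Z]
    (h : ∀ ε : ℝ, 0 < ε → ∃ δ : ℝ, 0 < δ ∧ ∀ x y : Z,
      ‖x‖ < 1 → ‖y‖ < 1 → ε < ‖x - y‖ → ‖x + y‖ ≤ 2 * (1 - δ))
    {Φ : StrongDual ℝ (StrongDual ℝ Z)} (hΦ : ‖Φ‖ = 1) :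
    ∃ x, inclusionInDoubleDual ℝ Z x = Φ := by
  set J : Z → WeakDual ℝ (StrongDual ℝ Z) :=
    fun x ↦ StrongDual.toWeakDual (inclusionInDoubleDual ℝ Z x)
  set l : Filter Z := comap J (𝓝 (StrongDual.toWeakDual Φ)) ⊓ 𝓟 (Metric.ball 0 1)
  have hne : l.NeBot := by
    have := mem_closure_iff_clusterPt.1
      (toWeakDual_mem_closure_inclusionInDoubleDual_image_ball hΦ.le)
    rw [ClusterPt, ← map_principal, ← Filter.push_pull', map_neBot_iff] at this
    exact this
  have htends : ∀ f : StrongDual ℝ Z, Tendsto (fun x ↦ f x) l (𝓝 (Φ f)) := fun f ↦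
    ((WeakDual.eval_continuous f).tendsto (StrongDual.toWeakDual Φ)).comp
      (tendsto_comap.mono_left inf_le_left)
  have hball : ∀ᶠ x in l, ‖x‖ < 1 := by
    filter_upwards [mem_inf_of_right (mem_principal_self (Metric.ball (0 : Z) 1))] with x hx
    simpa using hx
  have hcauchy : Cauchy l := by
    refine Metric.cauchy_iff.2 ⟨hne, fun ε hε ↦ ?_⟩
    obtain ⟨δ, hδ, hδε⟩ := h (ε / 2) (half_pos hε)
    obtain ⟨f, hf, hfΦ⟩ :=
      exists_norm_lt_one_lt_apply_of_lt_opNorm Φ (r := 1 - δ) (by linarith)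
    refine ⟨_, inter_mem hball ((htends f).eventually_const_lt hfΦ), ?_⟩
    rintro x ⟨hx, hfx⟩ y ⟨hy, hfy⟩
    simp only [Set.mem_ofPred_eq] at hx hfx hy hfy
    rw [dist_eq_norm]
    by_contra! hxy
    have hle : f (x + y) ≤ ‖x + y‖ := (le_abs_self _).trans <|
      (f.le_of_opNorm_le hf.le (x + y)).trans_eq (one_mul _)
    have := hδε x y hx hy (by linarith)
    rw [map_add] at hle
    linarith
  obtain ⟨x, hx⟩ := CompleteSpace.complete hcauchy
  exact ⟨x, ContinuousLinearMap.ext fun f ↦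
    tendsto_nhds_unique ((f.continuous.tendsto x).mono_left hx) (htends f)⟩

/-- a Banach space satisfying the stated uniform convexity type condition is
reflexive: the canonical inclusion into the double dual is surjective. -/
theorem statement12 (Z : Type*) [NormedAddCommGroup Z] [NormedSpace ℝ Z] [CompleteSpace Z]
    (h : ∀ ε : ℝ, 0 < ε → ∃ δ : ℝ, 0 < δ ∧ ∀ x y : Z,
      ‖x‖ < 1 → ‖y‖ < 1 → ε < ‖x - y‖ → ‖x + y‖ ≤ 2 * (1 - δ)) :
    Function.Surjective (NormedSpace.inclusionInDoubleDual ℝ Z) := by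
  intro Φ
  rcases eq_or_ne Φ 0 with rfl | hΦ
  · exact ⟨0, map_zero _⟩
  · have hnorm : ‖‖Φ‖⁻¹ • Φ‖ = 1 := by
      rw [norm_smul, norm_inv, norm_norm, inv_mul_cancel₀ (norm_ne_zero_iff.2 hΦ)]
    obtain ⟨x, hx⟩ := exists_inclusionInDoubleDual_eq_of_norm_eq_one h hnorm
    refine ⟨‖Φ‖ • x, ?_⟩
    rw [map_smul, hx]
    exact smul_inv_smul₀ (norm_ne_zero_iff.2 hΦ) Φ
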